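/- Let p_1, …, p_c ∈ H with ‖p_j‖ ≤ P, let r, h₁, h₂ ∈ H with ‖h₁‖ ≤ B and ‖h₂‖ ≤ B, let β_c > 0, γ > 0, η > 0, and let z ∈ {1,…,c} satisfy ⟨r, p_z⟩ ≥ ⟨r, p_j⟩ + γ for every j ≠ z and ⟨h₂, p_z⟩ ≥ ⟨h₁, p_z⟩ + η. Define w = Σ_{j=1}^{c} α_j p_j with α_j = exp(β_c ⟨r, p_j⟩)/Σ_{k=1}^{c} exp(β_c ⟨r, p_k⟩). Then ⟨h₂, w⟩ − ⟨h₁, w⟩ ≥ η − 4BP(c − 1) e^{−β_c γ}. -/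

import Mathlib

open Finset
open scoped RealInnerProductSpace

/-- Softmax weights with temperature `β` on a score vector `s : Fin c → ℝ`. -/
noncomputable def softmax {c : ℕ} (β : ℝ) (s : Fin c → ℝ) (j : Fin c) : ℝ :=
  Real.exp (β * s j) / ∑ k, Real.exp (β * s k)

theorem softmax_nonneg {c : ℕ} (β : ℝ) (s : Fin c → ℝ) (j : Fin c) : 0 ≤ softmax β s j :=
  div_nonneg (Real.exp_pos _).le (sum_nonneg fun _ _ => (Real.exp_pos _).le)

theorem sum_softmax_eq_one {c : ℕ} [NeZero c] (β : ℝ) (s : Fin c → ℝ) :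
    ∑ j, softmax β s j = 1 := by
  have h : 0 < ∑ k, Real.exp (β * s k) :=
    sum_pos (fun _ _ => Real.exp_pos _) univ_nonempty
  simp only [softmax, ← sum_div]
  exact div_self h.ne'

/-- A score trailing another one by at least `γ` gets softmax weight at most `exp (-(β * γ))`. -/
theorem softmax_le_exp_neg {c : ℕ} {β γ : ℝ} (hβ : 0 ≤ β) (s : Fin c → ℝ) {j z : Fin c}
    (h : s j + γ ≤ s z) : softmax β s j ≤ Real.exp (-(β * γ)) := by
  have hz : Real.exp (β * s z) ≤ ∑ k, Real.exp (β * s k) :=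
    single_le_sum (f := fun k => Real.exp (β * s k)) (fun _ _ => (Real.exp_pos _).le) (mem_univ z)
  rw [softmax, div_le_iff₀ ((Real.exp_pos _).trans_le hz)]
  calc Real.exp (β * s j) ≤ Real.exp (-(β * γ)) * Real.exp (β * s z) := by
        rw [← Real.exp_add, Real.exp_le_exp]
        linarith [mul_le_mul_of_nonneg_left h hβ]
    _ ≤ _ := by gcongr

/-- A convex combination of values within `D` of `x z`, whose weights off `z` are at most `ε`,
falls below `x z` by at most `(c - 1) * (ε * D)`. -/
theorem sub_le_sum_mul_of_weights_le {c : ℕ} {a x : Fin c → ℝ} {z : Fin c} {D ε : ℝ}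
    (ha : ∀ j, 0 ≤ a j) (hsum : ∑ j, a j = 1) (hε : ∀ j, j ≠ z → a j ≤ ε)
    (hD : 0 ≤ D) (hx : ∀ j, x z - x j ≤ D) :
    x z - ((c : ℝ) - 1) * (ε * D) ≤ ∑ j, a j * x j := by
  have hterm : ∑ j ∈ univ.erase z, a j * (x z - x j) ≤ ((c : ℝ) - 1) * (ε * D) := by
    calc ∑ j ∈ univ.erase z, a j * (x z - x j) ≤ ∑ _j ∈ univ.erase z, ε * D :=
          sum_le_sum fun j hj => (mul_le_mul_of_nonneg_left (hx j) (ha j)).trans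
            (mul_le_mul_of_nonneg_right (hε j (ne_of_mem_erase hj)) hD)
      _ = ((c : ℝ) - 1) * (ε * D) := by
          rw [sum_const, nsmul_eq_mul, card_erase_of_mem (mem_univ z), card_univ,
            Fintype.card_fin, Nat.cast_pred z.pos]
  rw [sum_erase _ (by simp)] at hterm
  simp only [mul_sub, sum_sub_distrib, ← sum_mul, hsum] at hterm
  linarith

/-- Under a class margin `⟨r, p_z⟩ ≥ ⟨r, p_j⟩ + γ` (for `j ≠ z`) and a hop margin
`⟨h₂, p_z⟩ ≥ ⟨h₁, p_z⟩ + η`, the bank-conditioned scores satisfy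
`⟨h₂, w⟩ − ⟨h₁, w⟩ ≥ η − 4BP(c−1) e^{−β_c γ}`, where `w = Σ_j α_j p_j` with softmax
weights `α_j` of temperature `β_c` on scores `⟨r, p_j⟩`. -/
theorem bank_conditioned_hop_margin {H : Type*} [NormedAddCommGroup H]
    [InnerProductSpace ℝ H] {c : ℕ} (p : Fin c → H) (P B : ℝ) (hp : ∀ j, ‖p j‖ ≤ P)
    (r h₁ h₂ : H) (hb1 : ‖h₁‖ ≤ B) (hb2 : ‖h₂‖ ≤ B)
    (βc γ η : ℝ) (hβc : 0 < βc) (hγ : 0 < γ) (hη : 0 < η) (z : Fin c)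
    (hmargin : ∀ j, j ≠ z → ⟪r, p j⟫ + γ ≤ ⟪r, p z⟫)
    (hhop : ⟪h₁, p z⟫ + η ≤ ⟪h₂, p z⟫)
    (w : H) (hw : w = ∑ j, softmax βc (fun k => ⟪r, p k⟫) j • p j) :
    η - 4 * B * P * ((c : ℝ) - 1) * Real.exp (-(βc * γ)) ≤ ⟪h₂, w⟫ - ⟪h₁, w⟫ := by
  have : NeZero c := ⟨z.pos.ne'⟩
  have hB : 0 ≤ B := (norm_nonneg _).trans hb1
  have hP : 0 ≤ P := (norm_nonneg _).trans (hp z)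
  have hinner : ∀ j, |⟪h₂ - h₁, p j⟫| ≤ 2 * B * P := fun j => by
    have hd : ‖h₂ - h₁‖ ≤ 2 * B := (norm_sub_le _ _).trans (by linarith)
    exact (abs_real_inner_le_norm _ _).trans
      (mul_le_mul hd (hp j) (norm_nonneg _) (by positivity))
  have key := sub_le_sum_mul_of_weights_le (x := fun j => ⟪h₂ - h₁, p j⟫) (z := z)
    (D := 4 * B * P) (softmax_nonneg βc fun k => ⟪r, p k⟫) (sum_softmax_eq_one _ _)
    (fun j hj => softmax_le_exp_neg hβc.le _ (hmargin j hj)) (by positivity)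
    (fun j => by linarith [(abs_le.mp (hinner j)).1, (abs_le.mp (hinner z)).2])
  have hsum : ⟪h₂, w⟫ - ⟪h₁, w⟫ =
      ∑ j, softmax βc (fun k => ⟪r, p k⟫) j * ⟪h₂ - h₁, p j⟫ := by
    rw [← inner_sub_left, hw, inner_sum]
    simp only [real_inner_smul_right]
  rw [hsum]
  have hz : ⟪h₂ - h₁, p z⟫ = ⟪h₂, p z⟫ - ⟪h₁, p z⟫ := inner_sub_left _ _ _
  linarith
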